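/- Let n be an odd positive integer and let C be the cyclic code of length n over Z_4 corresponding to the ideal ⟨f(x)g(x), 2f(x)⟩ of R_n = Z_4[x]/⟨x^n−1⟩, where f(x), g(x), h(x) are monic pairwise coprime polynomials with x^n−1 = f(x)g(x)h(x). Then Hull(C) is the cyclic code corresponding to the ideal ⟨lcm(f(x)g(x), h*(x)g*(x)), 2·lcm(f(x), h*(x))⟩ of R_n. -/

import Mathlib

open Polynomial

abbrev Z4 := ZMod 4

noncomputable abbrev Rn (n : ℕ) : Type :=
  Polynomial Z4 ⧸ Ideal.span {(X : Polynomial Z4) ^ n - 1}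

/-- The `Z4`-linear map sending a word `u ∈ Z4^n` to the polynomial `∑ u_i x^i`. -/
noncomputable def toPoly (n : ℕ) : (Fin n → Z4) →ₗ[Z4] Polynomial Z4 where
  toFun u := ∑ i : Fin n, Polynomial.C (u i) * X ^ (i : ℕ)
  map_add' u v := by
    simp [add_mul, Finset.sum_add_distrib]
  map_smul' c u := by
    simp [Finset.mul_sum, smul_eq_mul, mul_assoc, Polynomial.smul_eq_C_mul]

/-- The cyclic code (as a `Z4`-submodule of `Z4^n`) corresponding to an ideal of
`Rn n = Z4[x]/(x^n - 1)` under `u ↦ u_0 + u_1 x + ⋯ + u_{n-1} x^{n-1}`. -/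
noncomputable def codeOf (n : ℕ) (I : Ideal (Rn n)) : Submodule Z4 (Fin n → Z4) :=
  Submodule.comap
    ((Ideal.Quotient.mkₐ Z4 (Ideal.span {(X : Polynomial Z4) ^ n - 1})).toLinearMap ∘ₗ toPoly n)
    (Submodule.restrictScalars Z4 I)

/-- The dual code under the standard inner product on `Z4^n`. -/
def dualCode (n : ℕ) (C : Submodule Z4 (Fin n → Z4)) : Submodule Z4 (Fin n → Z4) where
  carrier := {u | ∀ c ∈ C, ∑ i, u i * c i = 0}
  zero_mem' := by intro c hc; simp
  add_mem' := by
    intro a b ha hb c hc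
    have h1 := ha c hc
    have h2 := hb c hc
    simp only [Pi.add_apply, add_mul, Finset.sum_add_distrib, h1, h2, add_zero]
  smul_mem' := by
    intro a u hu c hc
    have h := hu c hc
    simp only [Pi.smul_apply, smul_eq_mul, mul_assoc, ← Finset.mul_sum, h, mul_zero]

/-- The hull of the cyclic code corresponding to the ideal `I`. -/
noncomputable def hullCode (n : ℕ) (I : Ideal (Rn n)) : Submodule Z4 (Fin n → Z4) :=
  codeOf n I ⊓ dualCode n (codeOf n I)

/-- The reciprocal polynomial `f*(x) = a_0⁻¹ x^(deg f) f(1/x)`. -/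
noncomputable def recip (p : Polynomial Z4) : Polynomial Z4 :=
  Polynomial.C (Ring.inverse (p.coeff 0)) * p.reverse

/-- `l` is a least common multiple of `a` and `b` with respect to divisibility. -/
def IsDvdLcm {R : Type*} [CommRing R] (a b l : R) : Prop :=
  a ∣ l ∧ b ∣ l ∧ ∀ m, a ∣ m → b ∣ m → l ∣ m

instance Z4.nontrivial : Nontrivial Z4 :=
  ⟨0, 1, by decide⟩

/-- A simultaneous approximate multiple of two complementary-coprime factors of the same element
can be lifted to an exact one. -/
theorem exists_dvd_dvd_dvd_sub {A : Type*} [CommRing A] {a a' b b' c m s s' t t' : A}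
    (hab : a * a' = b * b') (ha : IsCoprime a a') (hb : IsCoprime b b')
    (hs : m = a * s + c * t) (hs' : m = b * s' + c * t') :
    ∃ m', a ∣ m' ∧ b ∣ m' ∧ c ∣ m - m' := by
  obtain ⟨u, v, huv⟩ := ha
  obtain ⟨w, z, hwz⟩ := hb
  refine ⟨m * (u * a) * (w * b) + a * a' * (v * s + u * a * z * s'),
    ⟨m * u * (w * b) + a' * (v * s + u * a * z * s'), by ring⟩,
    ⟨m * (u * a) * w + b' * (v * s + u * a * z * s'), by rw [hab]; ring⟩,
    ⟨t * v * a' + u * a * t' * z * b', ?_⟩⟩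
  linear_combination (-m) * huv - (u * a * m) * hwz + v * a' * hs + u * a * z * b' * hs' -
    u * a * z * s' * hab

theorem Polynomial.four_eq_zero : (4 : Z4[X]) = 0 := by
  have h : (4 : Z4) = 0 := by decide
  calc (4 : Z4[X]) = C 4 := (map_ofNat C 4).symm
    _ = 0 := by rw [h, C_0]

theorem Polynomial.two_dvd_of_two_mul_eq_zero {p : Z4[X]} (hp : 2 * p = 0) : 2 ∣ p := by
  rw [← map_ofNat (C : Z4 →+* Z4[X]) 2, C_dvd_iff_dvd_coeff]
  intro i
  have h : (2 : Z4) * p.coeff i = 0 := by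
    rw [← coeff_C_mul, map_ofNat, hp, coeff_zero]
  generalize p.coeff i = a at h
  revert a
  decide

theorem Polynomial.Monic.exists_eq_mul_add_two_mul {p t : Z4[X]} (hp : p.Monic)
    (h : p ∣ 2 * t) : ∃ s r, t = p * s + 2 * r := by
  have h2 : 2 * (t %ₘ p) = 0 := by
    rw [← modByMonic_eq_zero_iff_dvd hp, ← map_ofNat (C : Z4 →+* Z4[X]) 2, ← smul_eq_C_mul,
      smul_modByMonic, smul_eq_C_mul, map_ofNat] at h
    exact h
  obtain ⟨r, hr⟩ := two_dvd_of_two_mul_eq_zero h2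
  exact ⟨t /ₘ p, r, by rw [← hr, add_comm, modByMonic_add_div]⟩

theorem Ideal.span_pair_two_mul_inf {a a' b b' f f' k k' L₁ L₂ : Z4[X]}
    (hab : a * a' = b * b') (ha : IsCoprime a a') (hb : IsCoprime b b')
    (hfk : f * f' = k * k') (hf : IsCoprime f f') (hk : IsCoprime k k')
    (hfm : f.Monic) (hkm : k.Monic) (hfa : f ∣ a) (hkb : k ∣ b)
    (hL₁ : IsDvdLcm a b L₁) (hL₂ : IsDvdLcm f k L₂) :
    Ideal.span {a, 2 * f} ⊓ Ideal.span {b, 2 * k} = Ideal.span {L₁, 2 * L₂} := by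
  obtain ⟨haL, hbL, hL⟩ := hL₁
  obtain ⟨hfL, hkL, hL'⟩ := hL₂
  apply le_antisymm
  · rintro m ⟨h1, h2⟩
    obtain ⟨s, t, hst⟩ := Ideal.mem_span_pair.1 h1
    obtain ⟨s', t', hst'⟩ := Ideal.mem_span_pair.1 h2
    obtain ⟨m', ham, hbm, r, hr⟩ := exists_dvd_dvd_dvd_sub (c := 2) (m := m) (s := s) (t := t * f)
      (s' := s') (t' := t' * k) hab ha hb (by rw [← hst]; ring) (by rw [← hst']; ring)
    have hfr : f ∣ 2 * r := by
      rw [← hr, ← hst]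
      exact dvd_sub (dvd_add (hfa.mul_left _) ⟨t * 2, by ring⟩) (hfa.trans ham)
    have hkr : k ∣ 2 * r := by
      rw [← hr, ← hst']
      exact dvd_sub (dvd_add (hkb.mul_left _) ⟨t' * 2, by ring⟩) (hkb.trans hbm)
    obtain ⟨s₁, r₁, h₁⟩ := hfm.exists_eq_mul_add_two_mul hfr
    obtain ⟨s₂, r₂, h₂⟩ := hkm.exists_eq_mul_add_two_mul hkr
    obtain ⟨r', hfr', hkr', q, hq⟩ := exists_dvd_dvd_dvd_sub hfk hf hk h₁ h₂
    obtain ⟨x, hx⟩ := hL _ ham hbm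
    obtain ⟨y, hy⟩ := hL' _ hfr' hkr'
    refine Ideal.mem_span_pair.2 ⟨x, y, ?_⟩
    linear_combination -hr - hx - 2 * hq - 2 * hy - q * four_eq_zero
  · obtain ⟨x, rfl⟩ := haL
    obtain ⟨y, hy⟩ := hbL
    obtain ⟨z, rfl⟩ := hfL
    obtain ⟨w, hw⟩ := hkL
    rw [Ideal.span_le]
    rintro _ (rfl | rfl)
    · exact ⟨Ideal.mem_span_pair.2 ⟨x, 0, by ring⟩, Ideal.mem_span_pair.2 ⟨y, 0, by rw [hy]; ring⟩⟩
    · exact ⟨Ideal.mem_span_pair.2 ⟨0, z, by ring⟩, Ideal.mem_span_pair.2 ⟨0, w, by rw [hw]; ring⟩⟩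

theorem recip_monic {p : Z4[X]} (hp : IsUnit (p.coeff 0)) : (recip p).Monic := by
  apply monic_C_mul_of_mul_leadingCoeff_eq_one
  rw [reverse_leadingCoeff, trailingCoeff, natTrailingDegree_eq_zero.2 (Or.inr hp.ne_zero),
    Ring.inverse_mul_cancel _ hp]

theorem recip_mul {p q : Z4[X]} (hp : p.Monic) (hq : q.Monic) :
    recip (p * q) = recip p * recip q := by
  rw [recip, recip, recip, reverse_mul (by simp [hp.leadingCoeff, hq.leadingCoeff]),
    mul_coeff_zero, Ring.mul_inverse_rev, C_mul]
  ring

theorem recip_X_pow_sub_one {n : ℕ} (hn : 0 < n) : recip ((X : Z4[X]) ^ n - 1) = X ^ n - 1 := by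
  have h1 : ((X : Z4[X]) ^ n).reverse = 1 := by
    have h := reverse_mul_X_pow (1 : Z4[X]) n
    rwa [one_mul, ← C_1, reverse_C] at h
  have h2 : (X ^ n - 1 : Z4[X]) = X ^ n + C (-1) := by simp [sub_eq_add_neg]
  have h3 : ((X ^ n - 1 : Z4[X]).coeff 0) = -1 := by simp [coeff_X_pow, hn.ne]
  have h4 : Ring.inverse (-1 : Z4) = -1 := by
    simpa using Ring.inverse_unit (-1 : Z4ˣ)
  rw [recip, h3, h4, h2, reverse_add_C, h1, natDegree_X_pow]
  simp

theorem X_pow_sub_one_dvd_X_pow_mul_sub_one {R : Type*} [CommRing R] (n k : ℕ) :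
    (X : R[X]) ^ n - 1 ∣ X ^ (n * k) - 1 := by
  simpa [pow_mul] using sub_dvd_pow_sub_pow ((X : R[X]) ^ n) 1 k

theorem dvd_mul_comp_iff_dvd_mul_recip {n : ℕ} (hn : 0 < n) {p : Z4[X]}
    (hp : IsUnit (p.coeff 0)) (q : Z4[X]) :
    X ^ n - 1 ∣ q * p.comp (X ^ (n - 1)) ↔ X ^ n - 1 ∣ q * recip p := by
  set N : Z4[X] := X ^ n - 1
  let φ := Ideal.Quotient.mk (Ideal.span {N})
  have hφ (r : Z4[X]) : N ∣ r ↔ φ r = 0 := by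
    rw [Ideal.Quotient.eq_zero_iff_mem, Ideal.mem_span_singleton]
  have hX : φ X ^ n = 1 := by
    rw [← sub_eq_zero, ← map_pow, ← map_one φ, ← map_sub, ← hφ]
  have hXX : φ X * φ X ^ (n - 1) = 1 := by rw [← pow_succ', Nat.sub_add_cancel hn, hX]
  let _ : Invertible (φ X ^ (n - 1)) := ⟨φ X, hXX, by rw [mul_comm, hXX]⟩
  have key := eval₂_reverse_mul_pow (φ.comp C) (φ X ^ (n - 1)) p
  have hinv : ⅟(φ X ^ (n - 1)) = φ X := rfl
  have hev (r s : Z4[X]) : eval₂ (φ.comp C) (φ s) r = φ (r.comp s) := by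
    rw [comp, hom_eval₂]
  rw [hinv, hev, comp_X, ← map_pow φ X, hev, map_pow] at key
  have hu : IsUnit ((φ X ^ (n - 1)) ^ p.natDegree) := (isUnit_of_invertible _).pow _
  have hc : IsUnit (φ (C (Ring.inverse (p.coeff 0)))) := by
    exact ((isUnit_ringInverse.2 hp).map C).map φ
  rw [hφ, hφ, map_mul, map_mul, recip, map_mul, ← key, ← mul_assoc, hu.mul_left_eq_zero,
    mul_left_comm, hc.mul_right_eq_zero]

/-- The constant coefficient of the reduction of a polynomial modulo `X ^ n - 1`. -/
noncomputable def constCoeffMod (n : ℕ) : Z4[X] →ₗ[Z4] Z4 :=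
  lcoeff Z4 0 ∘ₗ modByMonicHom (X ^ n - 1)

theorem monic_X_pow_sub_one {n : ℕ} (hn : 0 < n) : ((X : Z4[X]) ^ n - 1).Monic := by
  simpa using monic_X_pow_sub_C (1 : Z4) hn.ne'

theorem constCoeffMod_eq_of_dvd_sub {n : ℕ} (hn : 0 < n) {p q : Z4[X]}
    (h : X ^ n - 1 ∣ p - q) : constCoeffMod n p = constCoeffMod n q := by
  simp [constCoeffMod, modByMonicHom, modByMonic_eq_of_dvd_sub (monic_X_pow_sub_one hn) h]

theorem constCoeffMod_X_pow {n : ℕ} (hn : 0 < n) (k : ℕ) :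
    constCoeffMod n (X ^ k) = if n ∣ k then 1 else 0 := by
  have h : (X : Z4[X]) ^ n - 1 ∣ X ^ k - X ^ (k % n) := by
    have := (X_pow_sub_one_dvd_X_pow_mul_sub_one (R := Z4) n (k / n)).mul_left (X ^ (k % n))
    rwa [mul_sub, ← pow_add, Nat.mod_add_div, mul_one] at this
  have hd : ((X : Z4[X]) ^ (k % n)).degree < ((X : Z4[X]) ^ n - 1).degree := by
    rw [← C_1, degree_X_pow_sub_C hn, degree_X_pow]
    exact_mod_cast Nat.mod_lt k hn
  rw [constCoeffMod_eq_of_dvd_sub hn h]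
  simp [constCoeffMod, modByMonicHom, (modByMonic_eq_self_iff (monic_X_pow_sub_one hn)).2 hd,
    coeff_X_pow, Nat.dvd_iff_mod_eq_zero, eq_comm]

theorem constCoeffMod_X_pow_mul {n : ℕ} (i j : Fin n) :
    constCoeffMod n (X ^ (i : ℕ) * (X ^ (n - 1)) ^ (j : ℕ)) = if i = j then 1 else 0 := by
  have hn : 0 < n := i.pos
  rw [← pow_mul, ← pow_add, constCoeffMod_X_pow hn]
  congr 1
  have h : (i : ℕ) + (n - 1) * j + j = i + n * j := by
    obtain ⟨k, rfl⟩ := Nat.exists_eq_succ_of_ne_zero hn.ne'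
    simp only [Nat.succ_eq_add_one, Nat.add_sub_cancel]
    ring
  rw [eq_iff_iff, Fin.ext_iff, ← Nat.modEq_zero_iff_dvd]
  constructor
  · intro h0
    have h1 : (i : ℕ) + n * j ≡ 0 + j [MOD n] := h ▸ h0.add_right j
    have h2 : (i : ℕ) ≡ j [MOD n] := by
      simpa [Nat.ModEq] using h1
    exact h2.eq_of_lt_of_lt i.2 j.2
  · intro hij
    apply Nat.ModEq.add_right_cancel' (j : ℕ)
    rw [h, hij]
    simp [Nat.ModEq]

theorem constCoeffMod_toPoly_mul_X_pow {n : ℕ} (u : Fin n → Z4) (j : Fin n) :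
    constCoeffMod n (toPoly n u * (X ^ (n - 1)) ^ (j : ℕ)) = u j := by
  simp only [toPoly, LinearMap.coe_mk, AddHom.coe_mk, Finset.sum_mul, map_sum,
    ← smul_eq_C_mul, smul_mul_assoc, map_smul, constCoeffMod_X_pow_mul]
  simp

theorem constCoeffMod_toPoly_mul_comp {n : ℕ} (u c : Fin n → Z4) :
    constCoeffMod n (toPoly n u * (toPoly n c).comp (X ^ (n - 1))) = ∑ i, u i * c i := by
  have h : (toPoly n c).comp (X ^ (n - 1)) = ∑ j, c j • ((X : Z4[X]) ^ (n - 1)) ^ (j : ℕ) := by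
    simp [toPoly, Polynomial.sum_comp, smul_eq_C_mul]
  rw [h, Finset.mul_sum, map_sum]
  refine Finset.sum_congr rfl fun j _ => ?_
  rw [mul_smul_comm, map_smul, constCoeffMod_toPoly_mul_X_pow, smul_eq_mul, mul_comm]

theorem exists_dvd_sub_toPoly {n : ℕ} (hn : 0 < n) (p : Z4[X]) :
    ∃ v, X ^ n - 1 ∣ p - toPoly n v := by
  set N : Z4[X] := X ^ n - 1 with hN
  have hm : N.Monic := monic_X_pow_sub_one hn
  have hd : (p %ₘ N).degree < n := by
    have h := degree_modByMonic_lt p hm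
    rwa [show N.degree = n by rw [hN, ← C_1, degree_X_pow_sub_C hn]] at h
  refine ⟨fun i => (p %ₘ N).coeff i, p /ₘ N, ?_⟩
  have h : toPoly n (fun i => (p %ₘ N).coeff i) = p %ₘ N := by
    simp only [toPoly, LinearMap.coe_mk, AddHom.coe_mk]
    rw [Fin.sum_univ_eq_sum_range (fun i => C ((p %ₘ N).coeff i) * X ^ i)]
    ext k
    simp only [finsetSum_coeff, coeff_C_mul, coeff_X_pow, mul_ite, mul_one, mul_zero,
      Finset.sum_ite_eq, Finset.mem_range, ite_eq_left_iff, not_lt]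
    intro hk
    exact (coeff_eq_zero_of_degree_lt (hd.trans_le (by exact_mod_cast hk))).symm
  rw [h, modByMonic_eq_sub_mul_div]
  ring

theorem mk_eq_mk_iff_dvd {n : ℕ} {p q : Z4[X]} :
    (Ideal.Quotient.mk _ p : Rn n) = Ideal.Quotient.mk _ q ↔ X ^ n - 1 ∣ p - q := by
  rw [Ideal.Quotient.eq, Ideal.mem_span_singleton]

theorem X_pow_sub_one_dvd_comp {n : ℕ} {p : Z4[X]} (h : X ^ n - 1 ∣ p) :
    X ^ n - 1 ∣ p.comp (X ^ (n - 1)) := by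
  obtain ⟨q, rfl⟩ := h
  rw [mul_comp]
  apply Dvd.dvd.mul_right
  simpa [← pow_mul, mul_comm] using X_pow_sub_one_dvd_X_pow_mul_sub_one (R := Z4) n (n - 1)

theorem mem_codeOf_iff {n : ℕ} {I : Ideal (Rn n)} {u : Fin n → Z4} :
    u ∈ codeOf n I ↔ Ideal.Quotient.mk _ (toPoly n u) ∈ I :=
  Iff.rfl

theorem mem_dualCode_codeOf_iff {n : ℕ} (hn : 0 < n) (I : Ideal (Rn n)) (u : Fin n → Z4) :
    u ∈ dualCode n (codeOf n I) ↔
      ∀ p : Z4[X], Ideal.Quotient.mk _ p ∈ I → X ^ n - 1 ∣ toPoly n u * p.comp (X ^ (n - 1)) := by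
  constructor
  · intro hu p hp
    obtain ⟨w, hw⟩ := exists_dvd_sub_toPoly hn (toPoly n u * p.comp (X ^ (n - 1)))
    have hw0 : w = 0 := by
      funext j
      obtain ⟨c, hc⟩ := exists_dvd_sub_toPoly hn (p * X ^ (j : ℕ))
      have hcI : c ∈ codeOf n I := by
        rw [mem_codeOf_iff, ← mk_eq_mk_iff_dvd.2 hc, map_mul]
        exact I.mul_mem_right _ hp
      rw [Pi.zero_apply, ← hu c hcI, ← constCoeffMod_toPoly_mul_comp,
        ← constCoeffMod_toPoly_mul_X_pow w j]
      apply constCoeffMod_eq_of_dvd_sub hn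
      have h1 := hw.mul_right ((X ^ (n - 1)) ^ (j : ℕ))
      have h2 := (X_pow_sub_one_dvd_comp hc).mul_left (toPoly n u)
      convert dvd_sub h2 h1 using 1
      simp only [sub_comp, mul_comp, pow_comp, X_comp]
      ring
    simpa [hw0] using hw
  · intro hu c hc
    rw [← constCoeffMod_toPoly_mul_comp, ← map_zero (constCoeffMod n)]
    apply constCoeffMod_eq_of_dvd_sub hn
    rw [sub_zero]
    exact hu _ hc

theorem mk_mem_span_pair_iff {n : ℕ} {a b : Z4[X]} (h : X ^ n - 1 ∈ Ideal.span {a, b})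
    (p : Z4[X]) :
    (Ideal.Quotient.mk _ p : Rn n) ∈ Ideal.span {Ideal.Quotient.mk _ a, Ideal.Quotient.mk _ b} ↔
      p ∈ Ideal.span {a, b} := by
  rw [← Set.image_pair, ← Ideal.map_span, Ideal.mem_quotient_iff_mem]
  rwa [Ideal.span_singleton_le_iff_mem]

theorem mem_dualCode_codeOf_span_pair_iff {n : ℕ} (hn : 0 < n) {a b : Z4[X]} (u : Fin n → Z4)
    (h : X ^ n - 1 ∈ Ideal.span {a, b}) :
    u ∈ dualCode n (codeOf n (Ideal.span {Ideal.Quotient.mk _ a, Ideal.Quotient.mk _ b})) ↔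
      X ^ n - 1 ∣ toPoly n u * a.comp (X ^ (n - 1)) ∧
        X ^ n - 1 ∣ toPoly n u * b.comp (X ^ (n - 1)) := by
  simp only [mem_dualCode_codeOf_iff hn, mk_mem_span_pair_iff h]
  refine ⟨fun H => ⟨H a (Ideal.subset_span (by simp)), H b (Ideal.subset_span (by simp))⟩, ?_⟩
  rintro ⟨ha, hb⟩ p hp
  obtain ⟨x, y, rfl⟩ := Ideal.mem_span_pair.1 hp
  convert dvd_add (ha.mul_left (x.comp (X ^ (n - 1)))) (hb.mul_left (y.comp (X ^ (n - 1)))) using 1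
  simp only [add_comp, mul_comp]
  ring

theorem mul_dvd_mul_two_mul_iff {f g k p : Z4[X]} (hf : f.Monic) (hg : g.Monic) (hk : k.Monic) :
    (f * g * k ∣ p * (f * g) ∧ f * g * k ∣ 2 * p * f) ↔ p ∈ Ideal.span {k * g, 2 * k} := by
  rw [Ideal.mem_span_pair]
  constructor
  · rintro ⟨⟨x, hx⟩, ⟨y, hy⟩⟩
    have hp : p = k * x := (hf.mul hg).isRegular.left (by linear_combination hx)
    have hp2 : 2 * p = k * (g * y) := hf.isRegular.left (by linear_combination hy)
    have hx2 : 2 * x = g * y := hk.isRegular.left (by linear_combination hp2 - 2 * hp)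
    obtain ⟨s, r, hsr⟩ := hg.exists_eq_mul_add_two_mul ⟨y, hx2⟩
    exact ⟨s, r, by rw [hp, hsr]; ring⟩
  · rintro ⟨s, r, rfl⟩
    exact ⟨⟨s * g + 2 * r, by ring⟩, ⟨2 * s, by linear_combination r * k * f * four_eq_zero⟩⟩

/-- **Hulls of cyclic codes over Z₄** (Theorem 3.2, generator form).
If `n` is odd and `C = ⟨f g, 2 f⟩ ⊆ Z4[x]/(x^n-1)` with `x^n - 1 = f g h` for monic
pairwise coprime `f, g, h`, then `Hull(C)` is the cyclic code corresponding to the ideal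
`⟨lcm(f g, h* g*), 2 lcm(f, h*)⟩`. -/
theorem hull_of_cyclic_code_eq_span
    (n : ℕ) (hn : Odd n) (hpos : 0 < n)
    (f g h : Polynomial Z4) (hf : f.Monic) (hg : g.Monic) (hh : h.Monic)
    (hfg : IsCoprime f g) (hfh : IsCoprime f h) (hgh : IsCoprime g h)
    (hfact : f * g * h = (X : Polynomial Z4) ^ n - 1)
    (C : Ideal (Rn n))
    (hC : C = Ideal.span
      {Ideal.Quotient.mk _ (f * g), Ideal.Quotient.mk _ (2 * f)})
    (L₁ L₂ : Polynomial Z4)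
    (hL₁ : IsDvdLcm (f * g) (recip h * recip g) L₁)
    (hL₂ : IsDvdLcm f (recip h) L₂) :
    hullCode n C = codeOf n (Ideal.span
      {Ideal.Quotient.mk _ L₁, Ideal.Quotient.mk _ (2 * L₂)}) := by
  subst hC
  have hunit : IsUnit (f.coeff 0) ∧ IsUnit (g.coeff 0) ∧ IsUnit (h.coeff 0) := by
    have h0 : f.coeff 0 * g.coeff 0 * h.coeff 0 = -1 := by
      rw [← mul_coeff_zero, ← mul_coeff_zero, hfact]
      simp [coeff_X_pow, hpos.ne]
    have h1 : IsUnit (f.coeff 0 * g.coeff 0 * h.coeff 0) := h0 ▸ isUnit_one.neg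
    rwa [IsUnit.mul_iff, IsUnit.mul_iff, and_assoc] at h1
  obtain ⟨hf0, hg0, hh0⟩ := hunit
  have hfact' : recip f * recip g * recip h = X ^ n - 1 := by
    rw [← recip_mul hf hg, ← recip_mul (hf.mul hg) hh, hfact, recip_X_pow_sub_one hpos]
  have hsep : ((X : Z4[X]) ^ n - 1).Separable := by
    have hu : IsUnit (n : Z4) := (ZMod.isUnit_iff_coprime n 4).2
      (hn.coprime_two_right.pow_right 2)
    simpa using separable_X_pow_sub_C_unit (1 : Z4ˣ) hu
  have hcop {a b : Z4[X]} (hab : a * b = X ^ n - 1) : IsCoprime a b :=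
    Separable.isCoprime (hab ▸ hsep)
  have e₁ : recip h * recip g * recip f = X ^ n - 1 := by rw [← hfact']; ring
  have e₂ : f * (g * h) = X ^ n - 1 := by rw [← hfact]; ring
  have e₃ : recip h * (recip g * recip f) = X ^ n - 1 := by rw [← hfact']; ring
  have hinf := Ideal.span_pair_two_mul_inf (hfact.trans e₁.symm) (hcop hfact) (hcop e₁)
    (e₂.trans e₃.symm) (hcop e₂) (hcop e₃) hf (recip_monic hh0) (dvd_mul_right _ _)
    (dvd_mul_right _ _) hL₁ hL₂
  have hN₁ : X ^ n - 1 ∈ Ideal.span {f * g, 2 * f} :=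
    Ideal.mem_span_pair.2 ⟨h, 0, by rw [← hfact]; ring⟩
  have hN₂ : X ^ n - 1 ∈ Ideal.span {recip h * recip g, 2 * recip h} :=
    Ideal.mem_span_pair.2 ⟨recip f, 0, by rw [← e₁]; ring⟩
  ext u
  have hdual : u ∈ dualCode n (codeOf n (Ideal.span
      {Ideal.Quotient.mk _ (f * g), Ideal.Quotient.mk _ (2 * f)})) ↔
      toPoly n u ∈ Ideal.span {recip h * recip g, 2 * recip h} := by
    rw [mem_dualCode_codeOf_span_pair_iff hpos u hN₁,
      ← mul_dvd_mul_two_mul_iff (recip_monic hf0) (recip_monic hg0) (recip_monic hh0), hfact',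
      ← recip_mul hf hg,
      ← dvd_mul_comp_iff_dvd_mul_recip hpos (by rw [mul_coeff_zero]; exact hf0.mul hg0),
      ← dvd_mul_comp_iff_dvd_mul_recip hpos hf0, mul_comp _ f, show (2 : Z4[X]).comp (X ^ (n - 1)) = 2 from ofNat_comp 2,
      mul_left_comm, mul_assoc 2]
  rw [hullCode, Submodule.mem_inf, hdual, mem_codeOf_iff, mem_codeOf_iff, mk_mem_span_pair_iff hN₁, mk_mem_span_pair_iff (hinf ▸ ⟨hN₁, hN₂⟩), ← hinf, Ideal.mem_inf]
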